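/- Let (X_n)_{n∈ℤ} be a strictly stationary reversible real-valued Markov chain, g square-integrable with ∫ g dπ = 0, and Y_i = g(X_i). Then for every integer n ≥ 2, (1/n) E( ( ∑_{k=1}^{n} E_{k-1}(Y_k) )² ) ≤ 2 E(Y_0 Y_2) + 2 ∑_{k=2}^{n} E(Y_0 Y_k). -/

import Mathlib

open MeasureTheory ProbabilityTheory Filter

noncomputable section

/-- The sigma-algebra generated by the past of the process up to time `k`. -/
def pastSigma {Ω : Type*} [MeasurableSpace Ω] (X : ℤ → Ω → ℝ) (k : ℤ) : MeasurableSpace Ω :=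
  ⨆ j : ℤ, ⨆ _ : j ≤ k, MeasurableSpace.comap (X j) inferInstance

/-- A strictly stationary, reversible, real-valued Markov chain indexed by `ℤ`. -/
structure IsStationaryReversibleMarkov {Ω : Type*} [MeasurableSpace Ω]
    (μ : Measure Ω) (X : ℤ → Ω → ℝ) : Prop where
  meas : ∀ n, Measurable (X n)
  stationary : ∀ n : ℤ,
    μ.map (fun ω => fun k : ℤ => X (k + n) ω) = μ.map (fun ω => fun k : ℤ => X k ω)
  reversible : μ.map (fun ω => (X 0 ω, X 1 ω)) = μ.map (fun ω => (X 1 ω, X 0 ω))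
  markov : ∀ (n : ℤ) (g : ℝ → ℝ), Measurable g → (∀ x, |g x| ≤ 1) →
    (μ[(fun ω => g (X (n + 1) ω)) | pastSigma X n]
      =ᵐ[μ] μ[(fun ω => g (X (n + 1) ω)) | MeasurableSpace.comap (X n) inferInstance])

/-- The action `f ↦ E(f(X₁) | X₀ = ·)` of the one-step transition kernel of the chain. -/
def transitionOp {Ω : Type*} [MeasurableSpace Ω] (μ : Measure Ω) [IsFiniteMeasure μ]
    (X : ℤ → Ω → ℝ) (f : ℝ → ℝ) : ℝ → ℝ :=
  fun x => ∫ y, f y ∂(condDistrib (X 1) (X 0) μ x)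

/-- If the conditional expectations given `m` of indicators of events of `Y` are given by the
kernel `κ` applied to `Z`, then so are those of all integrable functions of `Y`. -/
lemma condExp_comp_eq_integral_kernel {Ω β γ : Type*} [MeasurableSpace β] [MeasurableSpace γ]
    {m mΩ : MeasurableSpace Ω} {μ : Measure Ω} [IsProbabilityMeasure μ] (hm : m ≤ mΩ)
    {Y : Ω → γ} {Z : Ω → β} (hY : Measurable Y) (hZ : Measurable[m] Z)
    (κ : Kernel β γ) [IsMarkovKernel κ]
    (h : ∀ s, MeasurableSet s → μ⟦Y ⁻¹' s | m⟧ =ᵐ[μ] fun ω => (κ (Z ω)).real s)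
    {f : γ → ℝ} (hf : StronglyMeasurable f) (hfY : Integrable (fun ω => f (Y ω)) μ) :
    μ[fun ω => f (Y ω) | m] =ᵐ[μ] fun ω => ∫ y, f y ∂κ (Z ω) := by
  have hZ' : Measurable Z := hZ.mono hm le_rfl
  have key : ∀ A, MeasurableSet[m] A →
      (μ.restrict A).map Y = κ ∘ₘ ((μ.restrict A).map Z) := by
    intro A hA
    ext B hB
    have hint : Integrable (fun ω => (κ (Z ω)).real B) μ :=
      integrable_condExp.congr (h B hB)
    rw [Measure.map_apply hY hB, Measure.bind_apply hB κ.measurable.aemeasurable,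
      lintegral_map (κ.measurable_coe hB) hZ']
    have e1 : ∫⁻ ω in A, κ (Z ω) B ∂μ = ENNReal.ofReal (∫ ω in A, (κ (Z ω)).real B ∂μ) := by
      rw [ofReal_integral_eq_lintegral_ofReal hint.integrableOn
        (Eventually.of_forall fun _ => measureReal_nonneg)]
      simp
    rw [e1, ← setIntegral_congr_ae (hm A hA) ((h B hB).mono fun _ hx _ => hx),
      setIntegral_condExp hm ((integrable_const _).indicator (hY hB)) hA,
      integral_indicator_const _ (hY hB)]
    simp
  have hint : ∀ A, MeasurableSet[m] A → Integrable f (κ ∘ₘ ((μ.restrict A).map Z)) := by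
    intro A hA
    rw [← key A hA, integrable_map_measure hf.aestronglyMeasurable hY.aemeasurable]
    exact hfY.integrableOn
  have hmeas : StronglyMeasurable fun x => ∫ y, f y ∂κ x := hf.integral_kernel
  refine (ae_eq_condExp_of_forall_setIntegral_eq hm hfY ?_ ?_ ?_).symm
  · intro A hA _
    have h1 := hint A hA
    rw [Measure.comp_eq_comp_const_apply] at h1
    have h2 := h1.integral_comp
    simp only [Kernel.const_apply] at h2
    rwa [integrable_map_measure hmeas.aestronglyMeasurable hZ'.aemeasurable] at h2
  · intro A hA _
    have h1 := hint A hA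
    rw [Measure.comp_eq_comp_const_apply] at h1
    have h2 := Kernel.integral_comp h1
    rw [← Measure.comp_eq_comp_const_apply, ← key A hA,
      integral_map hY.aemeasurable hf.aestronglyMeasurable, Kernel.const_apply,
      integral_map hZ'.aemeasurable hmeas.aestronglyMeasurable] at h2
    exact h2.symm
  · exact (hmeas.comp_measurable hZ).aestronglyMeasurable

lemma pastSigma_le {Ω : Type*} [MeasurableSpace Ω] {X : ℤ → Ω → ℝ} (hX : ∀ n, Measurable (X n))
    (k : ℤ) : pastSigma X k ≤ ‹MeasurableSpace Ω› :=
  iSup₂_le fun j _ => (hX j).comap_le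

lemma measurable_pastSigma {Ω : Type*} [MeasurableSpace Ω] (X : ℤ → Ω → ℝ) {j k : ℤ}
    (hjk : j ≤ k) : Measurable[pastSigma X k] (X j) :=
  Measurable.of_comap_le
    (le_iSup₂_of_le (f := fun j _ => MeasurableSpace.comap (X j) _) j hjk le_rfl)

namespace IsStationaryReversibleMarkov

variable {Ω : Type*} [MeasurableSpace Ω] {μ : Measure Ω} {X : ℤ → Ω → ℝ}

lemma map_pair_shift (hX : IsStationaryReversibleMarkov μ X) (i j n : ℤ) :
    μ.map (fun ω => (X (i + n) ω, X (j + n) ω)) = μ.map (fun ω => (X i ω, X j ω)) := by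
  have hm := hX.meas
  have h := congrArg (fun ν => ν.map fun x : ℤ → ℝ => (x i, x j)) (hX.stationary n)
  beta_reduce at h
  rwa [Measure.map_map (by fun_prop) (by fun_prop), Measure.map_map (by fun_prop) (by fun_prop)]
    at h

lemma map_eq (hX : IsStationaryReversibleMarkov μ X) (n : ℤ) : μ.map (X n) = μ.map (X 0) := by
  have hm := hX.meas
  have h := congrArg (Measure.map Prod.fst) (hX.map_pair_shift 0 0 n)
  rw [Measure.map_map (by fun_prop) (by fun_prop), Measure.map_map (by fun_prop) (by fun_prop)]
    at h
  simpa [Function.comp_def] using h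

lemma integral_mul_shift (hX : IsStationaryReversibleMarkov μ X) {u v : ℝ → ℝ}
    (hu : Measurable u) (hv : Measurable v) (i j n : ℤ) :
    ∫ ω, u (X (i + n) ω) * v (X (j + n) ω) ∂μ = ∫ ω, u (X i ω) * v (X j ω) ∂μ := by
  have hm := hX.meas
  have hF : StronglyMeasurable fun p : ℝ × ℝ => u p.1 * v p.2 :=
    Measurable.stronglyMeasurable (by fun_prop)
  have h := congrArg (fun ν => ∫ p, u p.1 * v p.2 ∂ν) (hX.map_pair_shift i j n)
  beta_reduce at h
  rwa [integral_map (by fun_prop) hF.aestronglyMeasurable,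
    integral_map (by fun_prop) hF.aestronglyMeasurable] at h

lemma integral_mul_swap (hX : IsStationaryReversibleMarkov μ X) {u v : ℝ → ℝ}
    (hu : Measurable u) (hv : Measurable v) :
    ∫ ω, u (X 0 ω) * v (X 1 ω) ∂μ = ∫ ω, u (X 1 ω) * v (X 0 ω) ∂μ := by
  have hm := hX.meas
  have hF : StronglyMeasurable fun p : ℝ × ℝ => u p.1 * v p.2 :=
    Measurable.stronglyMeasurable (by fun_prop)
  have h := congrArg (fun ν => ∫ p, u p.1 * v p.2 ∂ν) hX.reversible
  beta_reduce at h
  rwa [integral_map (by fun_prop) hF.aestronglyMeasurable,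
    integral_map (by fun_prop) hF.aestronglyMeasurable] at h

lemma memLp_comp (hX : IsStationaryReversibleMarkov μ X) {u : ℝ → ℝ}
    (hu : MemLp u 2 (μ.map (X 0))) (n : ℤ) : MemLp (fun ω => u (X n ω)) 2 μ := by
  rw [← hX.map_eq n] at hu
  exact hu.comp_of_map (hX.meas n).aemeasurable

lemma abs_integral_mul_le (hX : IsStationaryReversibleMarkov μ X) {u : ℝ → ℝ}
    (hu : Measurable u) (hu2 : MemLp u 2 (μ.map (X 0))) (d : ℤ) :
    |∫ ω, u (X 0 ω) * u (X d ω) ∂μ| ≤ ∫ ω, u (X 0 ω) * u (X 0 ω) ∂μ := by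
  have i0 := (hX.memLp_comp hu2 0).integrable_mul (hX.memLp_comp hu2 0)
  have id := (hX.memLp_comp hu2 d).integrable_mul (hX.memLp_comp hu2 d)
  have i0d := (hX.memLp_comp hu2 0).integrable_mul (hX.memLp_comp hu2 d)
  have hdd : ∫ ω, u (X d ω) * u (X d ω) ∂μ = ∫ ω, u (X 0 ω) * u (X 0 ω) ∂μ := by
    simpa using hX.integral_mul_shift hu hu 0 0 d
  calc |∫ ω, u (X 0 ω) * u (X d ω) ∂μ|
      ≤ ∫ ω, |u (X 0 ω) * u (X d ω)| ∂μ := abs_integral_le_integral_abs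
    _ ≤ ∫ ω, (u (X 0 ω) * u (X 0 ω) + u (X d ω) * u (X d ω)) / 2 ∂μ := by
        refine integral_mono i0d.abs ((i0.add id).div_const 2) fun ω => ?_
        simp only [abs_le]
        constructor <;> nlinarith [sq_nonneg (u (X 0 ω) + u (X d ω)),
          sq_nonneg (u (X 0 ω) - u (X d ω))]
    _ = ∫ ω, u (X 0 ω) * u (X 0 ω) ∂μ := by
        rw [integral_div, integral_add (by exact i0) (by exact id), hdd]
        ring

variable [IsProbabilityMeasure μ]

lemma condExp_comp_succ (hX : IsStationaryReversibleMarkov μ X) {u : ℝ → ℝ}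
    (hu : Measurable u) (hu2 : MemLp u 2 (μ.map (X 0))) (n : ℤ) :
    μ[fun ω => u (X (n + 1) ω) | pastSigma X n] =ᵐ[μ] fun ω => transitionOp μ X u (X n ω) := by
  refine condExp_comp_eq_integral_kernel (pastSigma_le hX.meas n) (hX.meas _)
    (measurable_pastSigma X le_rfl) (condDistrib (X 1) (X 0) μ) (fun s hs => ?_)
    hu.stronglyMeasurable ((hX.memLp_comp hu2 _).integrable one_le_two)
  have hcd : condDistrib (X (n + 1)) (X n) μ = condDistrib (X 1) (X 0) μ := by
    have := hX.map_pair_shift 0 1 n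
    simp only [zero_add, add_comm (1 : ℤ)] at this
    rw [condDistrib, condDistrib]
    congr
  have h1 := hX.markov n (s.indicator fun _ => 1) (measurable_const.indicator hs) fun x => by
    by_cases hx : x ∈ s <;> simp [hx]
  have h2 := condDistrib_ae_eq_condExp (μ := μ) (hX.meas n) (hX.meas (n + 1)) hs
  rw [hcd] at h2
  exact h1.trans h2.symm

lemma measurable_transitionOp {u : ℝ → ℝ} (hu : Measurable u) :
    Measurable (transitionOp μ X u) :=
  hu.stronglyMeasurable.integral_kernel.measurable

lemma memLp_transitionOp (hX : IsStationaryReversibleMarkov μ X) {u : ℝ → ℝ}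
    (hu : Measurable u) (hu2 : MemLp u 2 (μ.map (X 0))) :
    MemLp (transitionOp μ X u) 2 (μ.map (X 0)) := by
  rw [memLp_map_measure_iff (measurable_transitionOp hu).aestronglyMeasurable
    (hX.meas 0).aemeasurable]
  exact ((hX.memLp_comp hu2 (0 + 1)).condExp one_le_two).ae_eq (hX.condExp_comp_succ hu hu2 0)

lemma integral_mul_succ (hX : IsStationaryReversibleMarkov μ X) {u v : ℝ → ℝ}
    (hu : Measurable u) (hu2 : MemLp u 2 (μ.map (X 0)))
    (hv : Measurable v) (hv2 : MemLp v 2 (μ.map (X 0))) (k : ℕ) :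
    ∫ ω, u (X 0 ω) * v (X (k + 1) ω) ∂μ = ∫ ω, u (X 0 ω) * transitionOp μ X v (X k ω) ∂μ := by
  have hint := (hX.memLp_comp hu2 0).integrable_mul (hX.memLp_comp hv2 (k + 1))
  have hpast : StronglyMeasurable[pastSigma X k] fun ω => u (X 0 ω) :=
    (hu.comp (measurable_pastSigma X (by positivity))).stronglyMeasurable
  have h := condExp_mul_of_stronglyMeasurable_left hpast hint
    ((hX.memLp_comp hv2 (k + 1)).integrable one_le_two)
  rw [← integral_condExp (pastSigma_le hX.meas k)]
  refine integral_congr_ae (h.trans ?_)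
  filter_upwards [hX.condExp_comp_succ hv hv2 k] with ω hω
  simp [hω]

lemma integral_transitionOp_mul (hX : IsStationaryReversibleMarkov μ X) {u v : ℝ → ℝ}
    (hu : Measurable u) (hu2 : MemLp u 2 (μ.map (X 0)))
    (hv : Measurable v) (hv2 : MemLp v 2 (μ.map (X 0))) :
    ∫ ω, transitionOp μ X u (X 0 ω) * v (X 0 ω) ∂μ =
      ∫ ω, u (X 0 ω) * transitionOp μ X v (X 0 ω) ∂μ := by
  have h1 := hX.integral_mul_succ hu hu2 hv hv2 0
  have h2 := hX.integral_mul_succ hv hv2 hu hu2 0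
  have h3 := hX.integral_mul_swap hu hv
  simp only [Nat.cast_zero, zero_add] at h1 h2
  simp only [mul_comm (v _)] at h2
  rw [← h1, ← h2, h3]

variable {g : ℝ → ℝ}

lemma measurable_iterate (hg : Measurable g) (k : ℕ) :
    Measurable ((transitionOp μ X)^[k] g) := by
  induction k with
  | zero => exact hg
  | succ k ih =>
    rw [Function.iterate_succ_apply']
    exact measurable_transitionOp ih

lemma memLp_iterate (hX : IsStationaryReversibleMarkov μ X) (hg : Measurable g)
    (hg2 : MemLp g 2 (μ.map (X 0))) (k : ℕ) :
    MemLp ((transitionOp μ X)^[k] g) 2 (μ.map (X 0)) := by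
  induction k with
  | zero => exact hg2
  | succ k ih =>
    rw [Function.iterate_succ_apply']
    exact hX.memLp_transitionOp (measurable_iterate hg k) ih

lemma integral_mul_eq_iterate (hX : IsStationaryReversibleMarkov μ X) (hg : Measurable g)
    (hg2 : MemLp g 2 (μ.map (X 0))) (p q d : ℕ) :
    ∫ ω, (transitionOp μ X)^[p] g (X 0 ω) * (transitionOp μ X)^[q] g (X d ω) ∂μ =
      ∫ ω, (transitionOp μ X)^[p] g (X 0 ω) * (transitionOp μ X)^[q + d] g (X 0 ω) ∂μ := by
  induction d generalizing q with
  | zero => simp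
  | succ d ih =>
    have h := hX.integral_mul_succ (measurable_iterate hg p) (hX.memLp_iterate hg hg2 p)
      (measurable_iterate hg q) (hX.memLp_iterate hg hg2 q) d
    rw [← Function.iterate_succ_apply' (transitionOp μ X), ih] at h
    push_cast
    rw [h, Nat.succ_add_eq_add_succ]

lemma integral_iterate_mul_iterate (hX : IsStationaryReversibleMarkov μ X) (hg : Measurable g)
    (hg2 : MemLp g 2 (μ.map (X 0))) (p q : ℕ) :
    ∫ ω, (transitionOp μ X)^[p] g (X 0 ω) * (transitionOp μ X)^[q] g (X 0 ω) ∂μ =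
      ∫ ω, g (X 0 ω) * (transitionOp μ X)^[q + p] g (X 0 ω) ∂μ := by
  induction p generalizing q with
  | zero => simp
  | succ p ih =>
    have h := hX.integral_transitionOp_mul (measurable_iterate hg p) (hX.memLp_iterate hg hg2 p)
      (measurable_iterate hg q) (hX.memLp_iterate hg hg2 q)
    rw [← Function.iterate_succ_apply' (transitionOp μ X),
      ← Function.iterate_succ_apply' (transitionOp μ X), ih] at h
    rw [h, Nat.succ_add_eq_add_succ]

/-- The autocovariances of `Qᵖ g` and `Q^q g`, with `Q` the transition operator, are those of `g`
at a larger lag. -/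
lemma integral_iterate_mul (hX : IsStationaryReversibleMarkov μ X) (hg : Measurable g)
    (hg2 : MemLp g 2 (μ.map (X 0))) (p q : ℕ) (i : ℤ) (d : ℕ) :
    ∫ ω, (transitionOp μ X)^[p] g (X i ω) * (transitionOp μ X)^[q] g (X (i + d) ω) ∂μ =
      ∫ ω, g (X 0 ω) * g (X ((p + q + d : ℕ) : ℤ) ω) ∂μ := by
  have h := hX.integral_mul_shift (measurable_iterate (μ := μ) (X := X) hg p)
    (measurable_iterate (μ := μ) (X := X) hg q) 0 d i
  rw [zero_add, add_comm] at h
  rw [h, hX.integral_mul_eq_iterate hg hg2, hX.integral_iterate_mul_iterate hg hg2]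
  have h2 := hX.integral_mul_eq_iterate hg hg2 0 0 (p + q + d)
  simp only [Function.iterate_zero, id, zero_add] at h2
  rw [h2, show q + d + p = p + q + d by omega]

end IsStationaryReversibleMarkov

/-- The sum of the entries of an `n × n` symmetric Toeplitz matrix. -/
lemma sum_sum_eq_of_toeplitz {C : ℕ → ℕ → ℝ} {b : ℕ → ℝ} (hC : ∀ i j, C i j = C j i)
    (hCb : ∀ i d, C i (i + d) = b d) (n : ℕ) :
    ∑ i ∈ Finset.range n, ∑ j ∈ Finset.range n, C i j =
      2 * n * ∑ d ∈ Finset.range n, b d - 2 * ∑ d ∈ Finset.range n, d * b d - n * b 0 := by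
  induction n with
  | zero => simp
  | succ n ih =>
    have hcol : ∑ i ∈ Finset.range n, C i n = ∑ d ∈ Finset.range (n + 1), b d - b 0 := by
      rw [Finset.sum_range_succ', add_sub_cancel_right,
        ← Finset.sum_range_reflect (fun d => b (d + 1))]
      refine Finset.sum_congr rfl fun i hi => ?_
      rw [← hCb i]
      congr 1
      have := Finset.mem_range.mp hi
      omega
    have hrow : ∑ j ∈ Finset.range n, C n j = ∑ d ∈ Finset.range (n + 1), b d - b 0 := by
      rw [← hcol]
      exact Finset.sum_congr rfl fun i _ => hC n i
    have hdiag : C n n = b 0 := hCb n 0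
    simp only [Finset.sum_range_succ, Finset.sum_add_distrib] at hcol hrow ⊢
    rw [ih, hcol, hrow, hdiag]
    push_cast
    ring

lemma neg_le_sum_range_mul {b : ℕ → ℝ} (heven : ∀ k, 0 ≤ b (2 * k))
    (hpair : ∀ k, 0 ≤ b (2 * k) + b (2 * k + 1)) (hb : ∀ d, |b d| ≤ b 0) (m : ℕ) :
    -(m / 2 * b 0) ≤ ∑ d ∈ Finset.range m, d * b d := by
  have h_even : ∀ k : ℕ, -(k * b 0) ≤ ∑ d ∈ Finset.range (2 * k), d * b d := by
    intro k
    induction k with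
    | zero => simp
    | succ k ih =>
      rw [Nat.mul_succ, Finset.sum_range_succ, Finset.sum_range_succ]
      push_cast
      have h1 := mul_nonneg (Nat.cast_nonneg (α := ℝ) (2 * k)) (hpair k)
      have h2 := neg_le_of_abs_le (hb (2 * k + 1))
      push_cast at h1
      linarith
  obtain ⟨k, rfl | rfl⟩ := m.even_or_odd'
  · refine le_of_eq_of_le ?_ (h_even k)
    push_cast
    ring
  · rw [Finset.sum_range_succ]
    have h1 := mul_nonneg (Nat.cast_nonneg (α := ℝ) (2 * k)) (heven k)
    have h2 := h_even k
    have h3 := heven 0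
    push_cast at h1 ⊢
    simp only [mul_zero] at h3
    linarith

lemma toeplitz_sum_le {b : ℕ → ℝ} (heven : ∀ k, 0 ≤ b (2 * k))
    (hpair : ∀ k, 0 ≤ b (2 * k) + b (2 * k + 1)) (hb : ∀ d, |b d| ≤ b 0) (m : ℕ) :
    2 * (m + 1 : ℕ) * ∑ d ∈ Finset.range (m + 1), b d
        - 2 * ∑ d ∈ Finset.range (m + 1), d * b d - (m + 1 : ℕ) * b 0 ≤
      (m + 1 : ℕ) * (2 * b 0 + 2 * ∑ d ∈ Finset.range m, b d) := by
  have h1 := neg_le_sum_range_mul heven hpair hb m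
  have h2 := le_of_abs_le (hb m)
  have h3 : 0 ≤ m * b 0 := mul_nonneg (Nat.cast_nonneg m) (heven 0)
  have h4 : 0 ≤ b 0 := heven 0
  rw [Finset.sum_range_succ, Finset.sum_range_succ]
  push_cast
  nlinarith

/-- For `n ≥ 2`: `(1/n) E((∑_{k=1}^n E_{k-1}(Y_k))²) ≤ 2 E(Y_0 Y_2) + 2 ∑_{k=2}^n E(Y_0 Y_k)`. -/
theorem var_sum_condexp_le {Ω : Type*} [MeasurableSpace Ω]
    (μ : Measure Ω) [IsProbabilityMeasure μ]
    (X : ℤ → Ω → ℝ) (hX : IsStationaryReversibleMarkov μ X)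
    (g : ℝ → ℝ) (hg_meas : Measurable g)
    (hg_sq : Integrable (fun x => g x ^ 2) (μ.map (X 0)))
    (hg_mean : ∫ x, g x ∂(μ.map (X 0)) = 0)
    (n : ℕ) (hn : 2 ≤ n) :
    (1 / (n : ℝ)) * ∫ ω,
        (∑ k ∈ Finset.Icc 1 n, (μ[(fun ω' => g (X (k : ℤ) ω')) | pastSigma X ((k : ℤ) - 1)]) ω) ^ 2 ∂μ
      ≤ 2 * (∫ ω, g (X 0 ω) * g (X 2 ω) ∂μ)
        + 2 * ∑ k ∈ Finset.Icc 2 n, ∫ ω, g (X 0 ω) * g (X (k : ℤ) ω) ∂μ := by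
  have hg2 : MemLp g 2 (μ.map (X 0)) :=
    (memLp_two_iff_integrable_sq hg_meas.aestronglyMeasurable).2 hg_sq
  have hu (k : ℕ) := IsStationaryReversibleMarkov.measurable_iterate (μ := μ) (X := X) hg_meas k
  have hu2 := hX.memLp_iterate hg_meas hg2
  set b : ℕ → ℝ := fun d => ∫ ω, g (X 0 ω) * g (X ((2 + d : ℕ) : ℤ) ω) ∂μ with hb
  have hsq (k : ℕ) : b (2 * k) =
      ∫ ω, (transitionOp μ X)^[k + 1] g (X 0 ω) * (transitionOp μ X)^[k + 1] g (X 0 ω) ∂μ := by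
    have h := hX.integral_iterate_mul hg_meas hg2 (k + 1) (k + 1) 0 0
    simp only [Nat.cast_zero, add_zero] at h
    rw [h, hb]
    congr! 6
    omega
  have heven (k : ℕ) : 0 ≤ b (2 * k) := by
    rw [hsq]
    exact integral_nonneg fun ω => mul_self_nonneg _
  have hpair (k : ℕ) : 0 ≤ b (2 * k) + b (2 * k + 1) := by
    have h := hX.integral_iterate_mul hg_meas hg2 (k + 1) (k + 1) 0 1
    have h1 : b (2 * k + 1) = ∫ ω, (transitionOp μ X)^[k + 1] g (X 0 ω) *
        (transitionOp μ X)^[k + 1] g (X (0 + (1 : ℕ)) ω) ∂μ := by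
      rw [h, hb]
      congr! 6
      omega
    have h2 := neg_le_of_abs_le (hX.abs_integral_mul_le (hu (k + 1)) (hu2 (k + 1)) (0 + (1 : ℕ)))
    rw [hsq, h1]
    linarith
  have habs (d : ℕ) : |b d| ≤ b 0 := by
    have h := hX.integral_iterate_mul hg_meas hg2 1 1 0 d
    have h2 := hX.abs_integral_mul_le (hu 1) (hu2 1) (0 + d)
    rw [h] at h2
    exact h2.trans_eq (hsq 0).symm
  have hcov (i d : ℕ) : ∫ ω, transitionOp μ X g (X i ω) * transitionOp μ X g (X (i + d : ℕ) ω) ∂μ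
      = b d := by
    exact_mod_cast hX.integral_iterate_mul hg_meas hg2 1 1 i d
  have hvar : ∫ ω, (∑ k ∈ Finset.Icc 1 n,
        (μ[(fun ω' => g (X (k : ℤ) ω')) | pastSigma X ((k : ℤ) - 1)]) ω) ^ 2 ∂μ =
      ∑ i ∈ Finset.range n, ∑ j ∈ Finset.range n,
        ∫ ω, transitionOp μ X g (X i ω) * transitionOp μ X g (X j ω) ∂μ := by
    have hL2 (i : ℕ) := hX.memLp_comp (hu2 1) i
    have hae : ∀ᵐ ω ∂μ, ∀ i : ℕ,
        (μ[(fun ω' => g (X ((i + 1 : ℕ) : ℤ) ω')) | pastSigma X (((i + 1 : ℕ) : ℤ) - 1)]) ω =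
          transitionOp μ X g (X i ω) := by
      rw [ae_all_iff]
      intro i
      have h := hX.condExp_comp_succ hg_meas hg2 i
      push_cast
      rwa [add_sub_cancel_right]
    have hsum : ∀ᵐ ω ∂μ, (∑ k ∈ Finset.Icc 1 n,
        (μ[(fun ω' => g (X (k : ℤ) ω')) | pastSigma X ((k : ℤ) - 1)]) ω) ^ 2 =
        ∑ i ∈ Finset.range n, ∑ j ∈ Finset.range n,
          transitionOp μ X g (X i ω) * transitionOp μ X g (X j ω) := by
      filter_upwards [hae] with ω hω
      rw [← Finset.Ico_add_one_right_eq_Icc, Finset.sum_Ico_eq_sum_range, sq,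
        Finset.sum_mul_sum]
      simp only [add_tsub_cancel_right, add_comm 1, hω]
    rw [integral_congr_ae hsum, integral_finsetSum]
    · refine Finset.sum_congr rfl fun i _ => integral_finsetSum _ fun j _ => ?_
      exact (hL2 i).integrable_mul (hL2 j)
    · exact fun i _ => integrable_finsetSum _ fun j _ => (hL2 i).integrable_mul (hL2 j)
  obtain ⟨m, rfl⟩ : ∃ m, n = m + 1 := ⟨n - 1, by omega⟩
  have hlags : ∑ k ∈ Finset.Icc 2 (m + 1), ∫ ω, g (X 0 ω) * g (X (k : ℤ) ω) ∂μ =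
      ∑ d ∈ Finset.range m, b d := by
    rw [← Finset.Ico_add_one_right_eq_Icc, Finset.sum_Ico_eq_sum_range]
    rfl
  have hfinal := toeplitz_sum_le heven hpair habs m
  rw [hvar, sum_sum_eq_of_toeplitz (fun i j => by simp only [mul_comm]) hcov, hlags,
    one_div, inv_mul_le_iff₀ (by positivity)]
  exact hfinal
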